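/- arXiv:0707.4269 — 7 statements merged into one kernel-verified Lean document; each statement's English description precedes it below -/
import Mathlib

section
/- Let H be a real Hilbert space, let S ⊆ H be a set of vectors with ‖v‖_H ≤ 1 for all v ∈ S, and let 0 < ε ≤ 1. Suppose f ∈ H satisfies ‖f‖_H² ≤ 1 and f is not ε-pseudorandom (i.e. there exists v ∈ S with |⟨f, v⟩_H| > ε, or ≥ ε). Then there exist v ∈ S and a real number c ∈ [−1/ε, 1/ε] such that |⟨f, v⟩_H| ≥ ε and ‖f − c·v‖_H² ≤ ‖f‖_H² − ε². -/
open scoped RealInnerProductSpace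

/-- Lack of pseudorandomness implies energy decrement. -/
theorem lack_of_pseudorandomness_implies_energy_decrement
    {H : Type*} [NormedAddCommGroup H] [InnerProductSpace ℝ H] [CompleteSpace H]
    (S : Set H) (hS : ∀ v ∈ S, ‖v‖ ≤ 1)
    (ε : ℝ) (hε0 : 0 < ε) (hε1 : ε ≤ 1)
    (f : H) (hf : ‖f‖ ^ 2 ≤ 1)
    (hnotpsd : ¬ ∀ v ∈ S, |(⟪f, v⟫)| ≤ ε) :
    ∃ v ∈ S, ∃ c : ℝ, c ∈ Set.Icc (-(1/ε)) (1/ε) ∧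
      ε ≤ |(⟪f, v⟫)| ∧ ‖f - c • v‖ ^ 2 ≤ ‖f‖ ^ 2 - ε ^ 2 := by
  push Not at hnotpsd
  obtain ⟨v, hv, h⟩ := hnotpsd
  have hv1 := hS v hv
  have hf1 : ‖f‖ ≤ 1 := by nlinarith [norm_nonneg f]
  have ha : |(⟪f, v⟫)| ≤ 1 := by
    have h1 := abs_real_inner_le_norm f v
    nlinarith [norm_nonneg f, norm_nonneg v]
  have hinv : 1 ≤ 1 / ε := by
    rw [le_div_iff₀ hε0]; linarith
  refine ⟨v, hv, ⟪f, v⟫, ?_, h.le, ?_⟩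
  · have h2 := abs_le.mp ha
    exact ⟨by linarith [h2.1], by linarith [h2.2]⟩
  · rw [norm_sub_sq_real, inner_smul_right, norm_smul, mul_pow, Real.norm_eq_abs]
    have h3 : |(⟪f, v⟫)| ^ 2 = ⟪f, v⟫ * ⟪f, v⟫ := by rw [sq_abs, sq]
    have h4 : ε ^ 2 ≤ |(⟪f, v⟫)| ^ 2 := pow_le_pow_left₀ hε0.le h.le 2
    have h5 : ‖v‖ ^ 2 ≤ 1 := pow_le_one₀ (norm_nonneg v) hv1
    have h6 : |(⟪f, v⟫)| ^ 2 * ‖v‖ ^ 2 ≤ |(⟪f, v⟫)| ^ 2 :=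
      mul_le_of_le_one_right (sq_nonneg _) h5
    linarith
end

section
/- Let H be a real Hilbert space, let S ⊆ H be a set of vectors with ‖v‖_H ≤ 1 for all v ∈ S, let f ∈ H with ‖f‖_H ≤ 1, and let 0 < ε ≤ 1. Then there exists a decomposition f = f_str + f_psd such that f_str is (1/ε², 1/ε)-structured and f_psd is ε-pseudorandom. -/
open scoped RealInnerProductSpace

/-- A vector `g` is `(M,K)`-structured with respect to the set `S` of basic structured
vectors if it is a linear combination of at most `M` vectors of `S` with coefficients
in `[-K, K]`. -/
def IsStructured {H : Type*} [NormedAddCommGroup H] [InnerProductSpace ℝ H]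
    (S : Set H) (M K : ℝ) (g : H) : Prop :=
  ∃ m : ℕ, (m : ℝ) ≤ M ∧ ∃ (v : Fin m → H) (c : Fin m → ℝ),
    (∀ i, v i ∈ S) ∧ (∀ i, |c i| ≤ K) ∧ g = ∑ i, c i • v i

/-- Non-orthogonal weak structure theorem. -/
theorem nonorthogonal_weak_structure_theorem
    {H : Type*} [NormedAddCommGroup H] [InnerProductSpace ℝ H] [CompleteSpace H]
    (S : Set H) (hS : ∀ v ∈ S, ‖v‖ ≤ 1)
    (f : H) (hf : ‖f‖ ≤ 1)
    (ε : ℝ) (hε0 : 0 < ε) (hε1 : ε ≤ 1) :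
    ∃ fstr fpsd : H, f = fstr + fpsd ∧
      IsStructured S (1 / ε ^ 2) (1 / ε) fstr ∧
      ∀ v ∈ S, |(⟪fpsd, v⟫)| ≤ ε := by
  by_contra hcon
  have key : ∀ n : ℕ, ∃ (v : Fin n → H) (c : Fin n → ℝ),
      (∀ i, v i ∈ S) ∧ (∀ i, |c i| ≤ 1 / ε) ∧
      ‖f - ∑ i, c i • v i‖ ^ 2 ≤ 1 - n * ε ^ 2 := by
    intro n
    induction n with
    | zero =>
      refine ⟨Fin.elim0, Fin.elim0, fun i => i.elim0, fun i => i.elim0, ?_⟩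
      simp only [Finset.univ_eq_empty, Finset.sum_empty, sub_zero, Nat.cast_zero, zero_mul]
      nlinarith [norm_nonneg f]
    | succ n ih =>
      obtain ⟨v, c, hv, hc, hn⟩ := ih
      set r := f - ∑ i, c i • v i with hr
      have hnε : (n : ℝ) ≤ 1 / ε ^ 2 := by
        rw [le_div_iff₀ (by positivity)]
        nlinarith [sq_nonneg ‖r‖]
      have hex : ∃ w ∈ S, ε < |⟪r, w⟫| := by
        by_contra hno
        push Not at hno
        exact hcon ⟨∑ i, c i • v i, r, by rw [hr]; abel, ⟨n, hnε, v, c, hv, hc, rfl⟩, hno⟩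
      obtain ⟨w, hw, hlt⟩ := hex
      have hw1 := hS w hw
      have hr1 : ‖r‖ ≤ 1 := by
        have : (0 : ℝ) ≤ n * ε ^ 2 := by positivity
        nlinarith [norm_nonneg r]
      have hc1 : |⟪r, w⟫| ≤ 1 := by
        have := abs_real_inner_le_norm r w
        nlinarith [norm_nonneg r, norm_nonneg w]
      refine ⟨Fin.snoc v w, Fin.snoc c ⟪r, w⟫, ?_, ?_, ?_⟩
      · intro i
        refine Fin.lastCases ?_ (fun j => ?_) i
        · simpa using hw
        · simpa using hv j
      · intro i
        refine Fin.lastCases ?_ (fun j => ?_) i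
        · simp only [Fin.snoc_last]
          exact hc1.trans ((le_div_iff₀ hε0).2 (by linarith))
        · simpa using hc j
      · have e : f - ∑ i, (Fin.snoc c ⟪r, w⟫ : Fin (n + 1) → ℝ) i •
            (Fin.snoc v w : Fin (n + 1) → H) i = r - ⟪r, w⟫ • w := by
          rw [Fin.sum_univ_castSucc]
          simp only [Fin.snoc_castSucc, Fin.snoc_last]
          rw [hr]; abel
        rw [e, norm_sub_sq_real, inner_smul_right, norm_smul, mul_pow, Real.norm_eq_abs, sq_abs]
        have h1 : ε ^ 2 ≤ ⟪r, w⟫ ^ 2 := by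
          rw [← sq_abs ⟪r, w⟫]
          exact pow_le_pow_left₀ hε0.le hlt.le 2
        have h2 : ‖w‖ ^ 2 ≤ 1 := by nlinarith [norm_nonneg w]
        push_cast
        nlinarith [mul_le_mul_of_nonneg_left h2 (sq_nonneg ⟪r, w⟫)]
  obtain ⟨n, hn⟩ := exists_nat_gt (1 / ε ^ 2)
  obtain ⟨v, c, -, -, h⟩ := key n
  rw [div_lt_iff₀ (by positivity)] at hn
  nlinarith [sq_nonneg ‖f - ∑ i, c i • v i‖]
end

section
/- For every 0 < ε ≤ 1 there is a constant C(ε) > 0, depending only on ε, with the following property: for every real Hilbert space H, every set S ⊆ H of vectors with ‖v‖_H ≤ 1 for all v ∈ S, and every f ∈ H with ‖f‖_H ≤ 1, there exists a decomposition f = f_str + f_psd such that f_str is (1/ε², C(ε))-structured, f_psd is ε-pseudorandom, and ⟨f_str, f_psd⟩_H = 0. -/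
open scoped RealInnerProductSpace

/-- State of the greedy algorithm after `k` steps. -/
def GreedyState {H : Type*} [NormedAddCommGroup H] [InnerProductSpace ℝ H]
    (S : Set H) (ε : ℝ) (f : H) (k : ℕ) : Prop :=
  ∃ (V : Submodule ℝ H) (_ : FiniteDimensional ℝ V) (v : Fin k → H),
    (∀ i, v i ∈ S) ∧ (∃ p ∈ V, ‖f - p‖ ^ 2 ≤ 1 - k * ε ^ 2) ∧
    (∀ x ∈ V, ‖x‖ ≤ 1 → ∃ c : Fin k → ℝ, (∀ i, |c i| ≤ (2 / ε) ^ k) ∧ x = ∑ i, c i • v i)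

theorem exists_proj {H : Type*} [NormedAddCommGroup H] [InnerProductSpace ℝ H]
    (V : Submodule ℝ H) [FiniteDimensional ℝ V] (f : H) :
    ∃ P ∈ V, ∀ y ∈ V, ⟪f - P, y⟫ = 0 := by
  refine ⟨V.starProjection f, V.starProjection_apply_mem f, fun y hy => ?_⟩
  exact V.starProjection_inner_eq_zero f y hy

theorem greedy_scale {H : Type*} [NormedAddCommGroup H] [InnerProductSpace ℝ H]
    {V : Submodule ℝ H} {k : ℕ} {v : Fin k → H} {B R : ℝ} (hR : 0 < R)
    (h : ∀ x ∈ V, ‖x‖ ≤ 1 → ∃ c : Fin k → ℝ, (∀ i, |c i| ≤ B) ∧ x = ∑ i, c i • v i)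
    (x : H) (hx : x ∈ V) (hn : ‖x‖ ≤ R) :
    ∃ c : Fin k → ℝ, (∀ i, |c i| ≤ R * B) ∧ x = ∑ i, c i • v i := by
  obtain ⟨c, hc, hs⟩ := h (R⁻¹ • x) (V.smul_mem _ hx) (by
    rw [norm_smul, Real.norm_eq_abs, abs_of_pos (inv_pos.2 hR), inv_mul_le_iff₀ hR]
    simpa using hn)
  refine ⟨fun i => R * c i, fun i => ?_, ?_⟩
  · rw [abs_mul, abs_of_pos hR]
    exact mul_le_mul_of_nonneg_left (hc i) hR.le
  · have : x = R • (R⁻¹ • x) := by rw [smul_smul, mul_inv_cancel₀ hR.ne', one_smul]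
    rw [this, hs, Finset.smul_sum]
    simp only [smul_smul]

theorem greedy_step {H : Type*} [NormedAddCommGroup H] [InnerProductSpace ℝ H]
    (S : Set H) (hS : ∀ v ∈ S, ‖v‖ ≤ 1) (ε : ℝ) (hε0 : 0 < ε) (hε1 : ε ≤ 1) (f : H)
    (hf : ‖f‖ ≤ 1) (k : ℕ) (h : GreedyState S ε f k) :
    (∃ fstr fpsd : H, f = fstr + fpsd ∧
            IsStructured S (1 / ε ^ 2) ((2 / ε) ^ ⌊1 / ε ^ 2⌋₊) fstr ∧
            (∀ v ∈ S, |(⟪fpsd, v⟫)| ≤ ε) ∧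
            (⟪fstr, fpsd⟫) = 0) ∨ GreedyState S ε f (k + 1) := by
  obtain ⟨V, hV, v, hv, ⟨p, hp, hpn⟩, hB⟩ := h
  obtain ⟨P, hP, hort⟩ := exists_proj V f
  have h2 : 1 ≤ 2 / ε := by rw [le_div_iff₀ hε0]; linarith
  have hfn : ‖f‖ ^ 2 = ‖f - P‖ ^ 2 + ‖P‖ ^ 2 := by
    have := norm_add_sq_real (f - P) P
    rw [hort P hP, sub_add_cancel] at this
    linarith
  have hfp : ‖f - p‖ ^ 2 = ‖f - P‖ ^ 2 + ‖P - p‖ ^ 2 := by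
    have := norm_add_sq_real (f - P) (P - p)
    rw [hort _ (V.sub_mem hP hp), sub_add_sub_cancel] at this
    linarith
  have hf2 : ‖f‖ ^ 2 ≤ 1 := by nlinarith [norm_nonneg f]
  have hP1 : ‖P‖ ≤ 1 := by
    rw [← sq_le_one_iff₀ (norm_nonneg _)]; nlinarith [sq_nonneg ‖f - P‖]
  have hr1 : ‖f - P‖ ≤ 1 := by
    rw [← sq_le_one_iff₀ (norm_nonneg _)]; nlinarith [sq_nonneg ‖P‖]
  have hrn : ‖f - P‖ ^ 2 ≤ 1 - k * ε ^ 2 := by nlinarith [sq_nonneg ‖P - p‖]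
  by_cases hps : ∀ w ∈ S, |(⟪f - P, w⟫)| ≤ ε
  · left
    have hk : (k : ℝ) ≤ 1 / ε ^ 2 := by
      rw [le_div_iff₀ (by positivity)]; nlinarith [sq_nonneg ‖f - P‖]
    refine ⟨P, f - P, by abel, ?_, hps, by rw [real_inner_comm]; exact hort P hP⟩
    obtain ⟨c, hc, hs⟩ := hB P hP hP1
    exact ⟨k, hk, v, c, hv, fun i => (hc i).trans (pow_le_pow_right₀ h2 (Nat.le_floor hk)), hs⟩
  · right
    push Not at hps
    obtain ⟨w, hw, hs⟩ := hps
    refine ⟨V ⊔ Submodule.span ℝ {w}, inferInstance, Fin.cons w v, ?_, ?_, ?_⟩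
    · intro i
      refine Fin.cases ?_ (fun i => ?_) i
      · simpa using hw
      · simpa using hv i
    · refine ⟨P + ⟪f - P, w⟫ • w, Submodule.add_mem_sup hP
        (Submodule.smul_mem _ _ (Submodule.mem_span_singleton_self w)), ?_⟩
      have e := norm_sub_sq_real (f - P) (⟪f - P, w⟫ • w)
      rw [← sub_sub, e, real_inner_smul_right, norm_smul, mul_pow, Real.norm_eq_abs, sq_abs]
      have hw2 : ‖w‖ ^ 2 ≤ 1 := by nlinarith [norm_nonneg w, hS w hw]
      have hs2 : ε ^ 2 ≤ ⟪f - P, w⟫ ^ 2 := by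
        rw [← sq_abs (⟪f - P, w⟫)]; exact pow_le_pow_left₀ hε0.le hs.le 2
      have := mul_le_mul_of_nonneg_left hw2 (sq_nonneg (⟪f - P, w⟫))
      push_cast
      nlinarith
    · intro x hx hx1
      obtain ⟨y, hy, z, hz, rfl⟩ := Submodule.mem_sup.1 hx
      obtain ⟨a, rfl⟩ := Submodule.mem_span_singleton.1 hz
      have ha : |a| * ε ≤ 1 := by
        have h1 : ⟪f - P, y + a • w⟫ = a * ⟪f - P, w⟫ := by
          rw [inner_add_right, hort y hy, real_inner_smul_right, zero_add]
        have h3 := abs_real_inner_le_norm (f - P) (y + a • w)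
        rw [h1, abs_mul] at h3
        have h4 : ‖f - P‖ * ‖y + a • w‖ ≤ 1 := mul_le_one₀ hr1 (norm_nonneg _) hx1
        have := mul_le_mul_of_nonneg_left hs.le (abs_nonneg a)
        linarith
      have ha' : |a| ≤ 1 / ε := by rwa [le_div_iff₀ hε0]
      have hyn : ‖y‖ ≤ 2 / ε := by
        have h1 : ‖y‖ ≤ ‖y + a • w‖ + ‖a • w‖ := by
          have := norm_sub_le (y + a • w) (a • w)
          rwa [add_sub_cancel_right] at this
        rw [norm_smul, Real.norm_eq_abs] at h1
        have h5 := mul_le_mul_of_nonneg_left (hS w hw) (abs_nonneg a)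
        have h6 : 1 ≤ 1 / ε := by rw [le_div_iff₀ hε0]; linarith
        have h7 : 2 / ε = 1 / ε + 1 / ε := by ring
        linarith
      obtain ⟨c, hc, hsum⟩ := greedy_scale (by positivity) hB y hy hyn
      refine ⟨Fin.cons a c, ?_, ?_⟩
      · intro i
        refine Fin.cases ?_ (fun i => ?_) i
        · simp only [Fin.cons_zero]
          have h8 : 1 / ε ≤ 2 / ε := by gcongr; norm_num
          exact (ha'.trans h8).trans (le_self_pow₀ h2 (Nat.succ_ne_zero k))
        · simp only [Fin.cons_succ]
          rw [pow_succ']; exact hc i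
      · rw [Fin.sum_univ_succ]
        simp only [Fin.cons_zero, Fin.cons_succ]
        rw [← hsum, add_comm]

/-- Orthogonal weak structure theorem. -/
theorem orthogonal_weak_structure_theorem (ε : ℝ) (hε0 : 0 < ε) (hε1 : ε ≤ 1) :
    ∃ C : ℝ, 0 < C ∧
      ∀ (H : Type*) [NormedAddCommGroup H] [InnerProductSpace ℝ H] [CompleteSpace H]
        (S : Set H), (∀ v ∈ S, ‖v‖ ≤ 1) →
        ∀ f : H, ‖f‖ ≤ 1 →
          ∃ fstr fpsd : H, f = fstr + fpsd ∧
            IsStructured S (1 / ε ^ 2) C fstr ∧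
            (∀ v ∈ S, |(⟪fpsd, v⟫)| ≤ ε) ∧
            (⟪fstr, fpsd⟫) = 0 := by
  refine ⟨(2 / ε) ^ ⌊1 / ε ^ 2⌋₊, by positivity, ?_⟩
  intro H _ _ _ S hS f hf
  by_contra hcon
  have key : ∀ k, GreedyState S ε f k := by
    intro k
    induction k with
    | zero =>
      refine ⟨⊥, inferInstance, Fin.elim0, fun i => i.elim0, ⟨0, Submodule.zero_mem _, ?_⟩, ?_⟩
      · simp only [sub_zero, Nat.cast_zero, zero_mul]
        nlinarith [norm_nonneg f]
      · intro x hx _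
        refine ⟨Fin.elim0, fun i => i.elim0, ?_⟩
        simpa using hx
    | succ k ih => exact (greedy_step S hS ε hε0 hε1 f hf k ih).resolve_left hcon
  obtain ⟨k, hk⟩ := exists_nat_gt (1 / ε ^ 2)
  obtain ⟨V, _, v, _, ⟨p, _, hp⟩, _⟩ := key k
  rw [div_lt_iff₀ (by positivity)] at hk
  nlinarith [sq_nonneg ‖f - p‖]
end

section
/- For every ε > 0 and every function F: ℤ⁺ → ℝ⁺ (taking positive real values) there is a bound M₀ = M₀(F, ε), depending only on F and ε, with the following property: for every real Hilbert space H, every set S ⊆ H of vectors with ‖v‖_H ≤ 1 for all v ∈ S, and every f ∈ H with ‖f‖_H ≤ 1, there exist a positive integer M ≤ M₀ and a decomposition f = f_str + f_psd + f_err such that f_str is (M,M)-structured, f_psd is 1/F(M)-pseudorandom, and ‖f_err‖_H ≤ ε. -/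
open scoped RealInnerProductSpace

theorem IsStructured.mono' {H : Type*} [NormedAddCommGroup H] [InnerProductSpace ℝ H]
    {S : Set H} {M K M' K' : ℝ} {g : H} (h : IsStructured S M K g) (hM : M ≤ M') (hK : K ≤ K') :
    IsStructured S M' K' g := by
  obtain ⟨m, hm, v, c, hv, hc, hg⟩ := h
  exact ⟨m, hm.trans hM, v, c, hv, fun i => (hc i).trans hK, hg⟩

theorem isStructured_zero' {H : Type*} [NormedAddCommGroup H] [InnerProductSpace ℝ H]
    {S : Set H} {M K : ℝ} (hM : 0 ≤ M) : IsStructured S M K 0 :=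
  ⟨0, by simpa using hM, fun i => i.elim0, fun i => i.elim0, fun i => i.elim0,
    fun i => i.elim0, by simp⟩

theorem IsStructured.add' {H : Type*} [NormedAddCommGroup H] [InnerProductSpace ℝ H]
    {S : Set H} {M N K : ℝ} {g h : H} (hg : IsStructured S M K g) (hh : IsStructured S N K h) :
    IsStructured S (M + N) K (g + h) := by
  obtain ⟨m, hm, v, c, hv, hc, rfl⟩ := hg
  obtain ⟨n, hn, w, d, hw, hd, rfl⟩ := hh
  refine ⟨m + n, by push_cast; linarith, Fin.append v w, Fin.append c d, ?_, ?_, ?_⟩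
  · intro i
    refine Fin.addCases (fun i => ?_) (fun i => ?_) i
    · simpa using hv i
    · simpa using hw i
  · intro i
    refine Fin.addCases (fun i => ?_) (fun i => ?_) i
    · simpa using hc i
    · simpa using hd i
  · simp [Fin.sum_univ_add]

theorem IsStructured.half' {H : Type*} [NormedAddCommGroup H] [InnerProductSpace ℝ H]
    {S : Set H} {M K : ℝ} {g : H} (hg : IsStructured S M K g) :
    IsStructured S M K ((1 / 2 : ℝ) • g) := by
  obtain ⟨m, hm, v, c, hv, hc, rfl⟩ := hg
  refine ⟨m, hm, v, fun i => (1 / 2) * c i, hv, fun i => ?_, ?_⟩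
  · have := hc i
    have h0 := abs_nonneg (c i)
    rw [abs_mul, abs_of_pos (by norm_num : (0 : ℝ) < 1 / 2)]
    linarith
  · simp [Finset.smul_sum, mul_smul]

/-- Greedy energy decrement. -/
theorem greedy_aux {H : Type*} [NormedAddCommGroup H] [InnerProductSpace ℝ H]
    {S : Set H} (hS : ∀ v ∈ S, ‖v‖ ≤ 1) {δ : ℝ} (hδ : 0 < δ) (n : ℕ) :
    ∀ r : H, ‖r‖ ≤ 1 → ‖r‖ ^ 2 ≤ n * δ ^ 2 →
      ∃ g : H, IsStructured S n 1 g ∧ (∀ v ∈ S, |(⟪r - g, v⟫)| ≤ δ) ∧ ‖r - g‖ ≤ ‖r‖ := by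
  induction n with
  | zero =>
    intro r _ h
    have hr : r = 0 := by
      have : ‖r‖ ^ 2 ≤ 0 := by simpa using h
      have : ‖r‖ = 0 := by nlinarith [norm_nonneg r]
      simpa using this
    subst hr
    exact ⟨0, isStructured_zero' (by simp), by simp [hδ.le], by simp⟩
  | succ n ih =>
    intro r hr1 h
    by_cases hp : ∀ v ∈ S, |(⟪r, v⟫)| ≤ δ
    · exact ⟨0, isStructured_zero' (by positivity), by simpa using hp, by simp⟩
    push Not at hp
    obtain ⟨v, hv, hvδ⟩ := hp
    have hv1 := hS v hv
    set c : ℝ := ⟪r, v⟫ with hc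
    have hc1 : |c| ≤ 1 := by
      have h1 : |c| ≤ ‖r‖ * ‖v‖ := abs_real_inner_le_norm r v
      nlinarith [norm_nonneg r, norm_nonneg v]
    have hcδ : δ ^ 2 ≤ c ^ 2 := by
      rw [← sq_abs c]; gcongr
    have hdec : ‖r - c • v‖ ^ 2 ≤ ‖r‖ ^ 2 - δ ^ 2 := by
      rw [norm_sub_sq_real, inner_smul_right, ← hc, norm_smul, mul_pow, Real.norm_eq_abs, sq_abs]
      have : ‖v‖ ^ 2 ≤ 1 := by nlinarith [norm_nonneg v]
      nlinarith [sq_nonneg c]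
    have hle : ‖r - c • v‖ ≤ ‖r‖ := by
      refine (pow_le_pow_iff_left₀ (norm_nonneg _) (norm_nonneg r) two_ne_zero).1 ?_
      nlinarith
    obtain ⟨g, hg, hgp, hgn⟩ := ih (r - c • v) (hle.trans hr1) (by push_cast at h; nlinarith)
    refine ⟨g + c • v, ?_, ?_, ?_⟩
    · have h1 : IsStructured S 1 1 (c • v) :=
        ⟨1, by simp, fun _ => v, fun _ => c, fun _ => hv, fun _ => hc1, by simp⟩
      simpa using hg.add' h1
    · have : r - (g + c • v) = r - c • v - g := by abel
      rwa [this]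
    · have : r - (g + c • v) = r - c • v - g := by abel
      rw [this]; exact hgn.trans hle



theorem strong_aux.{u} (ε : ℝ) (hε : 0 < ε)
    (F : ℕ → ℝ) (hF : ∀ M, 1 ≤ M → 0 < F M) (n : ℕ) : ∀ N : ℕ, 1 ≤ N →
    ∃ M₀ : ℕ,
      ∀ (H : Type u) [NormedAddCommGroup H] [InnerProductSpace ℝ H]
        (S : Set H), (∀ v ∈ S, ‖v‖ ≤ 1) →
        ∀ f g : H, ‖f - g‖ ≤ 1 → IsStructured S N N g → ‖f - g‖ ^ 2 ≤ n * (ε ^ 2 / 4) →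
          ∃ M : ℕ, 1 ≤ M ∧ M ≤ M₀ ∧
            ∃ fstr fpsd ferr : H, f = fstr + fpsd + ferr ∧
              IsStructured S (M : ℝ) (M : ℝ) fstr ∧
              (∀ v ∈ S, |(⟪fpsd, v⟫)| ≤ 1 / F M) ∧
              ‖ferr‖ ≤ ε := by
  induction n with
  | zero =>
    intro N hN
    refine ⟨N, fun H _ _ S hS f g _ hg h => ⟨N, hN, le_rfl, g, 0, f - g, by abel, hg, ?_, ?_⟩⟩
    · intro v _
      have := hF N hN
      simp [this.le]
    · have h2 : ‖f - g‖ ^ 2 ≤ 0 := by simpa using h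
      nlinarith [norm_nonneg (f - g)]
  | succ n ih =>
    intro N hN
    set k : ℕ := ⌈(F N) ^ 2⌉₊ with hk
    obtain ⟨M₁, hM₁⟩ := ih (N + (N + k)) (by omega)
    refine ⟨max N M₁, fun H _ _ S hS f g hfg hg h => ?_⟩
    have hFN := hF N hN
    have hkF : (F N) ^ 2 ≤ k := Nat.le_ceil _
    have hN' : (1 : ℝ) ≤ N := by exact_mod_cast hN
    have hk0 : (0 : ℝ) ≤ k := by positivity
    obtain ⟨p, hp, hpp, hpn⟩ := greedy_aux hS (δ := 1 / F N) (by positivity) k (f - g) hfg (by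
      have h1 : (1 : ℝ) ≤ k * (1 / F N) ^ 2 := by
        rw [one_div, inv_pow, ← div_eq_mul_inv, le_div_iff₀ (by positivity)]
        linarith
      nlinarith [norm_nonneg (f - g)])
    by_cases hpε : ‖p‖ ≤ ε
    · exact ⟨N, hN, le_max_left _ _, g, f - g - p, p, by abel, hg, hpp, hpε⟩
    push Not at hpε
    have hmid : ‖f - (g + (1 / 2 : ℝ) • p)‖ ^ 2 ≤ ‖f - g‖ ^ 2 - ε ^ 2 / 4 := by
      have e : f - (g + (1 / 2 : ℝ) • p) = (f - g) - (1 / 2 : ℝ) • p := by abel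
      have h1 : ‖f - g - p‖ ^ 2 ≤ ‖f - g‖ ^ 2 := by gcongr
      rw [norm_sub_sq_real] at h1
      rw [e, norm_sub_sq_real, inner_smul_right, norm_smul, mul_pow, Real.norm_eq_abs, sq_abs]
      have : ε ^ 2 ≤ ‖p‖ ^ 2 := by gcongr
      nlinarith
    have hle : ‖f - (g + (1 / 2 : ℝ) • p)‖ ≤ 1 := by
      refine (pow_le_pow_iff_left₀ (norm_nonneg _) zero_le_one two_ne_zero).1 ?_
      nlinarith [norm_nonneg (f - g)]
    obtain ⟨M, h1, h2, h3⟩ := hM₁ H S hS f (g + (1 / 2 : ℝ) • p) hle (by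
      have a := hp.half'.mono' (M' := (N : ℝ) + k) (K' := (N : ℝ)) (by linarith) hN'
      refine (hg.add' a).mono' (by push_cast; linarith) (by push_cast; linarith))
      (by push_cast at h; linarith)
    exact ⟨M, h1, h2.trans (le_max_right _ _), h3⟩

/-- Strong structure theorem in a Hilbert space. -/
theorem strong_structure_theorem (ε : ℝ) (hε : 0 < ε)
    (F : ℕ → ℝ) (hF : ∀ M, 1 ≤ M → 0 < F M) :
    ∃ M₀ : ℕ,
      ∀ (H : Type*) [NormedAddCommGroup H] [InnerProductSpace ℝ H] [CompleteSpace H]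
        (S : Set H), (∀ v ∈ S, ‖v‖ ≤ 1) →
        ∀ f : H, ‖f‖ ≤ 1 →
          ∃ M : ℕ, 1 ≤ M ∧ M ≤ M₀ ∧
            ∃ fstr fpsd ferr : H, f = fstr + fpsd + ferr ∧
              IsStructured S (M : ℝ) (M : ℝ) fstr ∧
              (∀ v ∈ S, |(⟪fpsd, v⟫)| ≤ 1 / F M) ∧
              ‖ferr‖ ≤ ε := by
  obtain ⟨n, hn⟩ := exists_nat_ge (1 / (ε ^ 2 / 4))
  obtain ⟨M₀, hM₀⟩ := strong_aux ε hε F hF n 1 le_rfl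
  refine ⟨M₀, fun H _ _ _ S hS f hf => ?_⟩
  refine hM₀ H S hS f 0 (by simpa using hf) (isStructured_zero' (by simp)) ?_
  have h1 : 1 ≤ n * (ε ^ 2 / 4) := (div_le_iff₀ (by positivity)).1 hn
  rw [sub_zero]
  nlinarith [norm_nonneg f]
end

section
/- (Arithmetic regularity lemma) For every 0 < ε ≤ 1 there is a constant C(ε), depending only on ε, with the following property: for every n ≥ 1 and every subset A ⊆ F₂ⁿ there exists a linear subspace V of F₂ⁿ of codimension d ≤ C(ε) such that A is ε-regular on all but at most ε·2^d of the 2^d affine translates y + V of V. -/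
open scoped Classical

/-- The character `x ↦ (-1)^{x·ξ}` on `F₂ⁿ`. -/
noncomputable def char2 {n : ℕ} (ξ x : Fin n → ZMod 2) : ℝ :=
  (-1 : ℝ) ^ (∑ i, x i * ξ i).val

/-- The affine translate `y + V` of a subspace `V` of `F₂ⁿ`, as a finset. -/
noncomputable def coset {n : ℕ} (V : Submodule (ZMod 2) (Fin n → ZMod 2))
    (y : Fin n → ZMod 2) : Finset (Fin n → ZMod 2) :=
  Finset.univ.filter (fun x => x - y ∈ V)

/-- The density `|A ∩ W| / |W|` of `A` in the translate `W = y + V`. -/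
noncomputable def cosetDensity {n : ℕ} (A : Finset (Fin n → ZMod 2))
    (V : Submodule (ZMod 2) (Fin n → ZMod 2)) (y : Fin n → ZMod 2) : ℝ :=
  (((coset V y).filter (fun x => x ∈ A)).card : ℝ) / ((coset V y).card : ℝ)

/-- `A` is `ε`-regular on the affine translate `y + V`:
for every character `e_ξ`, the average of `(1_A - δ_{y+V}) e_ξ` over `y + V`
is at most `ε` in absolute value. -/
noncomputable def IsRegularOn {n : ℕ} (A : Finset (Fin n → ZMod 2)) (ε : ℝ)
    (V : Submodule (ZMod 2) (Fin n → ZMod 2)) (y : Fin n → ZMod 2) : Prop :=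
  ∀ ξ : Fin n → ZMod 2,
    |(∑ x ∈ coset V y,
        ((if x ∈ A then (1 : ℝ) else 0) - cosetDensity A V y) * char2 ξ x) /
      ((coset V y).card : ℝ)| ≤ ε

section Aux

variable {n : ℕ}

/-- Size of the subspace, as the size of its trivial coset. -/
lemma coset_card_pos (V : Submodule (ZMod 2) (Fin n → ZMod 2)) (y : Fin n → ZMod 2) :
    0 < (coset V y).card :=
  Finset.card_pos.mpr ⟨y, by simp [coset]⟩

lemma coset_card (V : Submodule (ZMod 2) (Fin n → ZMod 2)) (y : Fin n → ZMod 2) :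
    (coset V y).card = Nat.card V := by
  rw [← Nat.card_eq_finsetCard]
  refine Nat.card_congr
    ⟨fun x => ⟨x.1 - y, (Finset.mem_filter.mp x.2).2⟩,
      fun v => ⟨v.1 + y, Finset.mem_filter.mpr ⟨Finset.mem_univ _, by simp⟩⟩, ?_, ?_⟩
  · intro x; simp
  · intro x; simp

lemma mem_coset (V : Submodule (ZMod 2) (Fin n → ZMod 2)) (x y : Fin n → ZMod 2) :
    x ∈ coset V y ↔ x - y ∈ V := by simp [coset]

lemma mem_coset_comm (V : Submodule (ZMod 2) (Fin n → ZMod 2)) (x y : Fin n → ZMod 2) :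
    x ∈ coset V y ↔ y ∈ coset V x := by
  rw [mem_coset, mem_coset, ← neg_sub, V.neg_mem_iff]

lemma coset_eq (V : Submodule (ZMod 2) (Fin n → ZMod 2)) {x y : Fin n → ZMod 2}
    (h : x - y ∈ V) : coset V x = coset V y := by
  ext z
  rw [mem_coset, mem_coset]
  constructor
  · intro hz
    have := V.add_mem hz h
    simpa using this
  · intro hz
    have := V.sub_mem hz h
    simpa using this

lemma density_eq (A : Finset (Fin n → ZMod 2)) (V : Submodule (ZMod 2) (Fin n → ZMod 2))
    (y : Fin n → ZMod 2) :
    cosetDensity A V y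
      = (∑ x ∈ coset V y, (if x ∈ A then (1 : ℝ) else 0)) / (Nat.card V : ℝ) := by
  unfold cosetDensity
  rw [coset_card]
  rw [← Finset.sum_filter]
  simp only [Finset.sum_const, nsmul_eq_mul, mul_one]

lemma density_inv (A : Finset (Fin n → ZMod 2)) (V : Submodule (ZMod 2) (Fin n → ZMod 2))
    {x y : Fin n → ZMod 2} (h : x - y ∈ V) : cosetDensity A V x = cosetDensity A V y := by
  unfold cosetDensity
  rw [coset_eq V h]

lemma sum_density_mul (A : Finset (Fin n → ZMod 2)) (V : Submodule (ZMod 2) (Fin n → ZMod 2))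
    (g : (Fin n → ZMod 2) → ℝ) (hg : ∀ x y, x - y ∈ V → g x = g y) :
    ∑ x, cosetDensity A V x * g x = ∑ x, (if x ∈ A then (1 : ℝ) else 0) * g x := by
  have hV : (Nat.card V : ℝ) ≠ 0 := by
    have := coset_card_pos V 0
    rw [coset_card] at this
    positivity
  have h1 : ∀ x, cosetDensity A V x * g x
      = ∑ z, if z ∈ coset V x then (if z ∈ A then (1 : ℝ) else 0) * g x / Nat.card V else 0 := by
    intro x
    rw [density_eq, ← Finset.sum_filter (s := Finset.univ) (p := fun z => z ∈ coset V x),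
      Finset.filter_univ_mem, Finset.sum_div, Finset.sum_mul]
    refine Finset.sum_congr rfl fun z _ => by ring
  simp_rw [h1]
  rw [Finset.sum_comm]
  refine Finset.sum_congr rfl fun z _ => ?_
  simp_rw [mem_coset_comm V z]
  rw [← Finset.sum_filter, Finset.filter_univ_mem]
  have : ∀ x ∈ coset V z, (if z ∈ A then (1 : ℝ) else 0) * g x / Nat.card V
      = (if z ∈ A then (1 : ℝ) else 0) * g z / Nat.card V := by
    intro x hx
    rw [hg x z ((mem_coset V x z).mp hx)]
  rw [Finset.sum_congr rfl this, Finset.sum_const, coset_card, nsmul_eq_mul]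
  field_simp

/-- The energy of `A` with respect to `V`. -/
noncomputable def energy (A : Finset (Fin n → ZMod 2))
    (V : Submodule (ZMod 2) (Fin n → ZMod 2)) : ℝ := ∑ x, cosetDensity A V x ^ 2

lemma energy_le (A : Finset (Fin n → ZMod 2)) (V : Submodule (ZMod 2) (Fin n → ZMod 2)) :
    energy A V ≤ 2 ^ n := by
  have h : ∀ x, cosetDensity A V x ^ 2 ≤ 1 := by
    intro x
    have h0 : 0 ≤ cosetDensity A V x := by unfold cosetDensity; positivity
    have h1 : cosetDensity A V x ≤ 1 := by
      unfold cosetDensity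
      apply div_le_one_of_le₀ _ (by positivity)
      exact_mod_cast Finset.card_filter_le _ _
    nlinarith
  calc energy A V ≤ ∑ x : Fin n → ZMod 2, (1 : ℝ) := Finset.sum_le_sum fun x _ => h x
    _ = 2 ^ n := by simp

lemma energy_diff (A : Finset (Fin n → ZMod 2)) {V V' : Submodule (ZMod 2) (Fin n → ZMod 2)}
    (h : V' ≤ V) :
    energy A V' - energy A V = ∑ x, (cosetDensity A V' x - cosetDensity A V x) ^ 2 := by
  have h1 := sum_density_mul A V' (cosetDensity A V) (fun x y hxy => density_inv A V (h hxy))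
  have h2 := sum_density_mul A V (cosetDensity A V) (fun x y hxy => density_inv A V hxy)
  have h3 : ∑ x, (cosetDensity A V' x - cosetDensity A V x) ^ 2
      = energy A V' - 2 * (∑ x, cosetDensity A V' x * cosetDensity A V x)
        + ∑ x, cosetDensity A V x * cosetDensity A V x := by
    unfold energy
    rw [Finset.mul_sum, ← Finset.sum_sub_distrib, ← Finset.sum_add_distrib]
    exact Finset.sum_congr rfl fun x _ => by ring
  have h4 : energy A V = ∑ x, cosetDensity A V x * cosetDensity A V x :=
    Finset.sum_congr rfl fun x _ => by ring
  rw [h3, h4, h1, h2]; ring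

/-- The linear functional attached to a frequency. -/
noncomputable def freq (ξ : Fin n → ZMod 2) : (Fin n → ZMod 2) →ₗ[ZMod 2] ZMod 2 :=
  ∑ i, ξ i • LinearMap.proj i

lemma char2_eq (ξ x : Fin n → ZMod 2) : char2 ξ x = (-1 : ℝ) ^ (freq ξ x).val := by
  unfold char2 freq
  simp [mul_comm]

lemma char2_sq (ξ x : Fin n → ZMod 2) : char2 ξ x ^ 2 = 1 := by
  unfold char2
  rw [← pow_mul, mul_comm, pow_mul]; simp

lemma char2_inv (ξ : Fin n → ZMod 2) {x y : Fin n → ZMod 2} (h : freq ξ (x - y) = 0) :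
    char2 ξ x = char2 ξ y := by
  rw [map_sub, sub_eq_zero] at h
  rw [char2_eq, char2_eq, h]

lemma local_increment (A : Finset (Fin n → ZMod 2))
    {V V' : Submodule (ZMod 2) (Fin n → ZMod 2)} (h : V' ≤ V) (ε : ℝ) (hε : 0 < ε)
    (y ξ : Fin n → ZMod 2) (hξ : ∀ x ∈ V', freq ξ x = 0)
    (hbad : ε < |(∑ x ∈ coset V y,
        ((if x ∈ A then (1 : ℝ) else 0) - cosetDensity A V y) * char2 ξ x) /
      ((coset V y).card : ℝ)|) :
    ε ^ 2 * Nat.card V ≤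
      ∑ x ∈ coset V y, (cosetDensity A V' x - cosetDensity A V x) ^ 2 := by
  have hVpos : (0 : ℝ) < Nat.card V := by
    have := coset_card_pos V 0
    rw [coset_card] at this
    exact_mod_cast this
  rw [coset_card, abs_div, abs_of_pos hVpos, lt_div_iff₀ hVpos] at hbad
  have key := sum_density_mul A V' (fun x => if x ∈ coset V y then char2 ξ x else 0) (by
    intro x z hxz
    have h1 : x ∈ coset V y ↔ z ∈ coset V y := by
      rw [mem_coset_comm V x, mem_coset_comm V z, coset_eq V (h hxz)]
    have h2 := char2_inv ξ (hξ _ hxz)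
    simp only [h1, h2])
  simp only [mul_ite, mul_zero] at key
  rw [← Finset.sum_filter, ← Finset.sum_filter, Finset.filter_univ_mem] at key
  have e : ∑ x ∈ coset V y,
        ((if x ∈ A then (1 : ℝ) else 0) - cosetDensity A V y) * char2 ξ x
      = ∑ x ∈ coset V y, (cosetDensity A V' x - cosetDensity A V x) * char2 ξ x := by
    simp only [sub_mul, Finset.sum_sub_distrib]
    rw [key]
    congr 1
    refine Finset.sum_congr rfl fun x hx => ?_
    rw [density_inv A V ((mem_coset V x y).mp hx)]
  rw [e] at hbad
  have cs := Finset.sum_mul_sq_le_sq_mul_sq (coset V y)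
    (fun x => cosetDensity A V' x - cosetDensity A V x) (char2 ξ)
  simp only [char2_sq, Finset.sum_const, coset_card, nsmul_eq_mul, mul_one] at cs
  have h5 : (ε * Nat.card V) ^ 2 ≤
      (∑ x ∈ coset V y, (cosetDensity A V' x - cosetDensity A V x) * char2 ξ x) ^ 2 := by
    rw [← sq_abs (∑ x ∈ coset V y, _)]
    exact pow_le_pow_left₀ (by positivity) hbad.le 2
  have h6 := h5.trans cs
  refine le_of_mul_le_mul_right ?_ hVpos
  calc _ = (ε * Nat.card V) ^ 2 := by ring
    _ ≤ _ := h6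

/-- The set of bad cosets. -/
abbrev Bad (A : Finset (Fin n → ZMod 2)) (ε : ℝ)
    (V : Submodule (ZMod 2) (Fin n → ZMod 2)) : Type :=
  {w : (Fin n → ZMod 2) ⧸ V //
              ∃ y : Fin n → ZMod 2, Submodule.Quotient.mk y = w ∧
                ¬ IsRegularOn A ε V y}

lemma card_quot (V : Submodule (ZMod 2) (Fin n → ZMod 2)) :
    Nat.card ((Fin n → ZMod 2) ⧸ V)
      = 2 ^ Module.finrank (ZMod 2) ((Fin n → ZMod 2) ⧸ V) := by
  have := Module.natCard_eq_pow_finrank (K := ZMod 2) (V := (Fin n → ZMod 2) ⧸ V)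
  simpa using this

lemma card_mul (V : Submodule (ZMod 2) (Fin n → ZMod 2)) :
    (Nat.card V : ℝ) * 2 ^ Module.finrank (ZMod 2) ((Fin n → ZMod 2) ⧸ V) = 2 ^ n := by
  have h := Submodule.card_eq_card_quotient_mul_card V
  rw [card_quot] at h
  have h2 : Nat.card (Fin n → ZMod 2) = 2 ^ n := by simp
  rw [h2] at h
  exact_mod_cast h.symm

lemma step (A : Finset (Fin n → ZMod 2)) (ε : ℝ) (hε : 0 < ε)
    (V : Submodule (ZMod 2) (Fin n → ZMod 2))
    (hbad : ¬ (Nat.card (Bad A ε V) : ℝ) ≤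
      ε * 2 ^ Module.finrank (ZMod 2) ((Fin n → ZMod 2) ⧸ V)) :
    ∃ V' : Submodule (ZMod 2) (Fin n → ZMod 2),
      Module.finrank (ZMod 2) ((Fin n → ZMod 2) ⧸ V') ≤
        Module.finrank (ZMod 2) ((Fin n → ZMod 2) ⧸ V)
          + 2 ^ Module.finrank (ZMod 2) ((Fin n → ZMod 2) ⧸ V) ∧
      energy A V + ε ^ 3 * 2 ^ n ≤ energy A V' := by
  have hch : ∀ w : Bad A ε V, ∃ y ξ : Fin n → ZMod 2, Submodule.Quotient.mk y = w.1 ∧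
      ε < |(∑ x ∈ coset V y,
        ((if x ∈ A then (1 : ℝ) else 0) - cosetDensity A V y) * char2 ξ x) /
      ((coset V y).card : ℝ)| := by
    rintro ⟨w, y, hy, hr⟩
    unfold IsRegularOn at hr
    push Not at hr
    obtain ⟨ξ, hξ⟩ := hr
    exact ⟨y, ξ, hy, hξ⟩
  choose y ξ hy hξ using hch
  let Φ : (Fin n → ZMod 2) →ₗ[ZMod 2] ((Fin n → ZMod 2) ⧸ V) × (Bad A ε V → ZMod 2) :=
    V.mkQ.prod (LinearMap.pi fun w => freq (ξ w))
  have hker : ∀ x ∈ LinearMap.ker Φ, x ∈ V ∧ ∀ w, freq (ξ w) x = 0 := by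
    intro x hx
    rw [LinearMap.mem_ker] at hx
    have h1 := congrArg Prod.fst hx
    have h2 := congrArg Prod.snd hx
    refine ⟨?_, fun w => congrFun h2 w⟩
    exact (Submodule.Quotient.mk_eq_zero V).mp h1
  have hle : LinearMap.ker Φ ≤ V := fun x hx => (hker x hx).1
  have hcard : (Nat.card (Bad A ε V)) ≤
      2 ^ Module.finrank (ZMod 2) ((Fin n → ZMod 2) ⧸ V) := by
    rw [← card_quot]
    exact Nat.card_le_card_of_injective _ Subtype.val_injective
  refine ⟨LinearMap.ker Φ, ?_, ?_⟩
  · rw [(Φ.quotKerEquivRange).finrank_eq]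
    refine (Submodule.finrank_le _).trans ?_
    rw [Module.finrank_prod, Module.finrank_fintype_fun_eq_card, ← Nat.card_eq_fintype_card]
    omega
  · have hd := energy_diff A hle
    have hloc : ∀ w : Bad A ε V, ε ^ 2 * Nat.card V ≤
        ∑ x ∈ coset V (y w), (cosetDensity A (LinearMap.ker Φ) x - cosetDensity A V x) ^ 2 :=
      fun w => local_increment A hle ε hε (y w) (ξ w) (fun x hx => (hker x hx).2 w) (hξ w)
    have hdisj : ((Finset.univ : Finset (Bad A ε V)) : Set (Bad A ε V)).PairwiseDisjoint
        (fun w => coset V (y w)) := by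
      intro w _ w' _ hne
      rw [Function.onFun, Finset.disjoint_left]
      intro x hx hx'
      apply hne
      rw [mem_coset] at hx hx'
      apply Subtype.ext
      rw [← hy w, ← hy w', ← (Submodule.Quotient.eq V).mpr hx, ← (Submodule.Quotient.eq V).mpr hx']
    have hsum : ∑ w : Bad A ε V, ∑ x ∈ coset V (y w),
        (cosetDensity A (LinearMap.ker Φ) x - cosetDensity A V x) ^ 2
        ≤ ∑ x, (cosetDensity A (LinearMap.ker Φ) x - cosetDensity A V x) ^ 2 := by
      rw [← Finset.sum_biUnion hdisj]
      exact Finset.sum_le_sum_of_subset_of_nonneg (Finset.subset_univ _)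
        (fun _ _ _ => sq_nonneg _)
    have hlow := Finset.sum_le_sum (s := Finset.univ) fun w _ => hloc w
    rw [Finset.sum_const, Finset.card_univ, ← Nat.card_eq_fintype_card, nsmul_eq_mul] at hlow
    push Not at hbad
    have hV := card_mul V
    have h7 : ε ^ 3 * 2 ^ n ≤ (Nat.card (Bad A ε V) : ℝ) * (ε ^ 2 * Nat.card V) := by
      calc ε ^ 3 * 2 ^ n
          = (ε * 2 ^ Module.finrank (ZMod 2) ((Fin n → ZMod 2) ⧸ V)) * (ε ^ 2 * Nat.card V) := by
            rw [← hV]; ring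
        _ ≤ _ := mul_le_mul_of_nonneg_right hbad.le (by positivity)
    linarith

lemma iterate (ε : ℝ) (hε : 0 < ε) (k : ℕ) : ∃ C : ℕ, ∀ n : ℕ,
    ∀ A : Finset (Fin n → ZMod 2), ∃ V : Submodule (ZMod 2) (Fin n → ZMod 2),
      Module.finrank (ZMod 2) ((Fin n → ZMod 2) ⧸ V) ≤ C ∧
      ((Nat.card (Bad A ε V) : ℝ) ≤
        ε * 2 ^ Module.finrank (ZMod 2) ((Fin n → ZMod 2) ⧸ V) ∨
        k * (ε ^ 3 * 2 ^ n) ≤ energy A V) := by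
  induction k with
  | zero =>
    refine ⟨0, fun n A => ⟨⊤, ?_, Or.inr ?_⟩⟩
    · exact (Module.finrank_zero_of_subsingleton).le
    · simp only [Nat.cast_zero, zero_mul]
      exact Finset.sum_nonneg fun _ _ => sq_nonneg _
  | succ k ih =>
    obtain ⟨C, hC⟩ := ih
    refine ⟨C + 2 ^ C, fun n A => ?_⟩
    obtain ⟨V, hV, h⟩ := hC n A
    by_cases hg : (Nat.card (Bad A ε V) : ℝ) ≤
        ε * 2 ^ Module.finrank (ZMod 2) ((Fin n → ZMod 2) ⧸ V)
    · exact ⟨V, hV.trans (Nat.le_add_right _ _), Or.inl hg⟩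
    · obtain ⟨V', h1, h2⟩ := step A ε hε V hg
      refine ⟨V', h1.trans (Nat.add_le_add hV (Nat.pow_le_pow_right (by norm_num) hV)),
        Or.inr ?_⟩
      have h3 := h.resolve_left hg
      push_cast
      linarith

end Aux

/-- the arithmetic regularity lemma of Green, in `F₂ⁿ`. -/
theorem arithmetic_regularity_lemma (ε : ℝ) (hε0 : 0 < ε) (hε1 : ε ≤ 1) :
    ∃ C : ℝ, ∀ n : ℕ, 1 ≤ n → ∀ A : Finset (Fin n → ZMod 2),
      ∃ d : ℕ, (d : ℝ) ≤ C ∧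
        ∃ V : Submodule (ZMod 2) (Fin n → ZMod 2),
          Module.finrank (ZMod 2) ((Fin n → ZMod 2) ⧸ V) = d ∧
          (Nat.card {w : (Fin n → ZMod 2) ⧸ V //
              ∃ y : Fin n → ZMod 2, Submodule.Quotient.mk y = w ∧
                ¬ IsRegularOn A ε V y} : ℝ) ≤ ε * 2 ^ d := by
  obtain ⟨k, hk⟩ := exists_nat_gt (1 / ε ^ 3)
  obtain ⟨C, hC⟩ := iterate ε hε0 k
  refine ⟨C, fun n _ A => ?_⟩
  obtain ⟨V, hV, h⟩ := hC n A
  refine ⟨_, by exact_mod_cast hV, V, rfl, ?_⟩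
  refine h.resolve_right fun h' => ?_
  have h1 := h'.trans (energy_le A V)
  rw [div_lt_iff₀ (by positivity)] at hk
  have h2 : (0 : ℝ) < 2 ^ n := by positivity
  nlinarith
end

section
/- (Szemerédi regularity lemma) For every 0 < ε < 1 and every integer m ≥ 1 there exist constants n₀(ε,m) and M₀(ε,m) with the following property: every graph G = (V,E) with |V| = n ≥ n₀(ε,m) vertices admits a partition V = V₀ ∪ V₁ ∪ … ∪ V_{m'} with m ≤ m' ≤ M₀(ε,m) such that |V₀| ≤ ε·n, the sets V₁, …, V_{m'} all have equal cardinality, and all but at most ε·(m')² of the pairs (V_i, V_j) with 1 ≤ i < j ≤ m' are ε-regular. -/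
open scoped Classical

/-- The number of edges of `G` between `A` and `B` (ordered pairs in `A × B` that are
adjacent); for disjoint `A`, `B` this is the number of edges with one endpoint in each. -/
noncomputable def edgeCount {V : Type*} [Fintype V] (G : SimpleGraph V)
    (A B : Finset V) : ℕ :=
  ((A ×ˢ B).filter (fun p => G.Adj p.1 p.2)).card

/-- The edge density `δ_{A,B} = e(A,B)/(|A||B|)` between `A` and `B`. -/
noncomputable def edgeDensityR {V : Type*} [Fintype V] (G : SimpleGraph V)
    (A B : Finset V) : ℝ :=
  (edgeCount G A B : ℝ) / ((A.card : ℝ) * (B.card : ℝ))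

/-- The pair `(A,B)` is `ε`-regular: for all `A' ⊆ A`, `B' ⊆ B` with `|A'| ≥ ε|A|` and
`|B'| ≥ ε|B|`, the number of edges between `A'` and `B'` differs from
`δ_{A,B}|A'||B'|` by at most `ε|A'||B'|`. -/
noncomputable def IsRegularPair {V : Type*} [Fintype V] (ε : ℝ) (G : SimpleGraph V)
    (A B : Finset V) : Prop :=
  ∀ A' ⊆ A, ∀ B' ⊆ B, ε * (A.card : ℝ) ≤ (A'.card : ℝ) →
    ε * (B.card : ℝ) ≤ (B'.card : ℝ) →
    |(edgeCount G A' B' : ℝ) - edgeDensityR G A B * (A'.card : ℝ) * (B'.card : ℝ)| ≤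
      ε * (A'.card : ℝ) * (B'.card : ℝ)

theorem edgeDensityR_eq {n : ℕ} (G : SimpleGraph (Fin n)) (A B : Finset (Fin n)) :
    edgeDensityR G A B = ((G.edgeDensity A B : ℚ) : ℝ) := by
  rw [← SimpleGraph.card_interedges_div_card]
  push_cast
  rfl

theorem regular_of_uniform {n : ℕ} (G : SimpleGraph (Fin n)) (ε : ℝ) (hε0 : 0 < ε) (hε1 : ε < 1)
    (q : ℕ) (hq : 1 ≤ q) (U W U' W' : Finset (Fin n)) (hU : U' ⊆ U) (hW : W' ⊆ W)
    (hU' : U'.card = q) (hW' : W'.card = q) (hUq : U.card ≤ q + 1) (hWq : W.card ≤ q + 1)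
    (h : G.IsUniform (ε / 4) U W) : IsRegularPair ε G U' W' := by
  intro A hA B hB hAc hBc
  have hq1 : (1 : ℝ) ≤ q := by exact_mod_cast hq
  have hUr : (U.card : ℝ) ≤ q + 1 := by exact_mod_cast hUq
  have hWr : (W.card : ℝ) ≤ q + 1 := by exact_mod_cast hWq
  rw [hU'] at hAc
  rw [hW'] at hBc
  have key : ∀ x : ℝ, x ≤ q + 1 → x * (ε / 4) ≤ ε * q := by
    intro x hx
    nlinarith
  have hqq : ε * q ≤ q := by nlinarith
  have h1 := h (hA.trans hU) (hB.trans hW) ((key _ hUr).trans hAc) ((key _ hWr).trans hBc)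
  have h2 := h hU hW (by rw [hU']; exact (key _ hUr).trans hqq)
    (by rw [hW']; exact (key _ hWr).trans hqq)
  have hApos : (0 : ℝ) < A.card := lt_of_lt_of_le (by positivity) hAc
  have hBpos : (0 : ℝ) < B.card := lt_of_lt_of_le (by positivity) hBc
  rw [← edgeDensityR_eq, ← edgeDensityR_eq] at h1 h2
  have h3 : |edgeDensityR G A B - edgeDensityR G U' W'| ≤ ε := by
    rw [abs_lt] at h1 h2
    rw [abs_le]
    constructor <;> linarith [h1.1, h1.2, h2.1, h2.2]
  have h4 : (edgeCount G A B : ℝ) = edgeDensityR G A B * A.card * B.card := by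
    unfold edgeDensityR
    field_simp
  rw [h4, ← sub_mul, ← sub_mul, abs_mul, abs_mul, abs_of_pos hApos, abs_of_pos hBpos]
  gcongr

/-- the Szemerédi regularity lemma. -/
theorem szemeredi_regularity_lemma (ε : ℝ) (hε0 : 0 < ε) (hε1 : ε < 1)
    (m : ℕ) (hm : 1 ≤ m) :
    ∃ n₀ M₀ : ℕ, ∀ n : ℕ, n₀ ≤ n → ∀ G : SimpleGraph (Fin n),
      ∃ m' : ℕ, m ≤ m' ∧ m' ≤ M₀ ∧
        ∃ P : Fin (m' + 1) → Finset (Fin n),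
          (∀ x, ∃ i, x ∈ P i) ∧
          (∀ i j, i ≠ j → Disjoint (P i) (P j)) ∧
          ((P 0).card : ℝ) ≤ ε * (n : ℝ) ∧
          (∀ i j, i ≠ 0 → j ≠ 0 → (P i).card = (P j).card) ∧
          ((Finset.univ.filter (fun p : Fin (m' + 1) × Fin (m' + 1) =>
              p.1 ≠ 0 ∧ p.1 < p.2 ∧ ¬ IsRegularPair ε G (P p.1) (P p.2))).card : ℝ) ≤
            ε * (m' : ℝ) ^ 2 := by
  obtain ⟨M₁, hM₁⟩ := exists_nat_ge ((SzemerediRegularity.bound (ε / 4) m : ℝ) / ε)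
  refine ⟨m + SzemerediRegularity.bound (ε / 4) m + M₁, SzemerediRegularity.bound (ε / 4) m, ?_⟩
  intro n hn G
  obtain ⟨Q, hQe, hmQ, hQM, hQu⟩ := szemeredi_regularity G (ε := ε / 4) (l := m) (by positivity)
    (by rw [Fintype.card_fin]; omega)
  obtain ⟨k, hk⟩ : ∃ k, k = Q.parts.card := ⟨_, rfl⟩
  rw [← hk] at hmQ hQM
  have hkpos : 0 < k := by omega
  obtain ⟨q, hqdef⟩ : ∃ q, q = n / k := ⟨_, rfl⟩
  have hq : 1 ≤ q := by rw [hqdef]; exact Nat.div_pos (by omega) hkpos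
  have hlow : ∀ U ∈ Q.parts, q ≤ U.card := by
    intro U hU
    have := hQe.average_le_card_part hU
    simpa [hqdef, hk] using this
  have hup : ∀ U ∈ Q.parts, U.card ≤ q + 1 := by
    intro U hU
    have := hQe.card_part_le_average_add_one hU
    simpa [hqdef, hk] using this
  have hsub : ∀ U : Finset (Fin n), ∃ U' ⊆ U, U ∈ Q.parts → U'.card = q := by
    intro U
    by_cases hU : U ∈ Q.parts
    · obtain ⟨U', h1, h2⟩ := Finset.exists_subset_card_eq (hlow U hU)
      exact ⟨U', h1, fun _ => h2⟩
    · exact ⟨U, subset_rfl, fun h => absurd h hU⟩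
  choose f hf hfc using hsub
  let e : Fin k ≃ Q.parts := (Q.parts.equivFinOfCardEq hk.symm).symm
  let g : Fin k → Finset (Fin n) := fun i => f (e i).1
  have hgc : ∀ i, (g i).card = q := fun i => hfc _ (e i).2
  have hgd : ∀ i j, i ≠ j → Disjoint (g i) (g j) := by
    intro i j hij
    have hne : (e i).1 ≠ (e j).1 := fun h => hij (e.injective (Subtype.ext h))
    exact (Q.disjoint (e i).2 (e j).2 hne).mono (hf _) (hf _)
  let R : Finset (Fin n) := Finset.univ \ Finset.univ.biUnion g
  have hRd : ∀ i, Disjoint R (g i) := fun i =>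
    Finset.sdiff_disjoint.mono_right (Finset.subset_biUnion_of_mem g (Finset.mem_univ i))
  refine ⟨k, hmQ, hQM, Fin.cons R g, ?_, ?_, ?_, ?_, ?_⟩
  · intro x
    by_cases hx : ∃ i, x ∈ g i
    · obtain ⟨i, hi⟩ := hx
      exact ⟨i.succ, by simpa using hi⟩
    · exact ⟨0, by simpa [R] using hx⟩
  · intro i j
    refine Fin.cases ?_ (fun i => ?_) i <;> refine Fin.cases ?_ (fun j => ?_) j
    · simp
    · intro _
      simpa using hRd j
    · intro _
      simpa using (hRd i).symm
    · intro h
      simpa using hgd i j (fun h' => h (by rw [h']))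
  · have hc : (Finset.univ.biUnion g).card = k * q := by
      rw [Finset.card_biUnion (fun i _ j _ h => hgd i j h)]
      simp [hgc]
    have hRc : R.card ≤ k := by
      simp only [R]
      rw [Finset.card_sdiff_of_subset (Finset.subset_univ _), hc, Finset.card_univ,
        Fintype.card_fin]
      have h1 := Nat.div_add_mod n k
      have h2 := Nat.mod_lt n hkpos
      rw [← hqdef] at h1
      omega
    have h1 : (R.card : ℝ) ≤ SzemerediRegularity.bound (ε / 4) m := by
      exact_mod_cast hRc.trans hQM
    have h2 : (M₁ : ℝ) ≤ n := by exact_mod_cast (by omega : M₁ ≤ n)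
    have h3 := (div_le_iff₀ hε0).1 (hM₁.trans h2)
    simp only [Fin.cons_zero]
    linarith
  · intro i j
    refine Fin.cases ?_ (fun i => ?_) i <;> refine Fin.cases ?_ (fun j => ?_) j <;> simp [hgc]
  · let F : Fin (k + 1) → Finset (Fin n) := Fin.cons ∅ (fun i => (e i).1)
    have hFinj : ∀ i j, i ≠ 0 → j ≠ 0 → F i = F j → i = j := by
      intro i j hi hj h
      obtain ⟨i, rfl⟩ := Fin.exists_succ_eq.2 hi
      obtain ⟨j, rfl⟩ := Fin.exists_succ_eq.2 hj
      have h' : (e i).1 = (e j).1 := by simpa [F] using h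
      rw [e.injective (Subtype.ext h')]
    have hle : (Finset.univ.filter (fun p : Fin (k + 1) × Fin (k + 1) =>
        p.1 ≠ 0 ∧ p.1 < p.2 ∧ ¬ IsRegularPair ε G
          ((Fin.cons R g : Fin (k + 1) → Finset (Fin n)) p.1)
          ((Fin.cons R g : Fin (k + 1) → Finset (Fin n)) p.2))).card ≤
        (Q.nonUniforms G (ε / 4)).card := by
      apply Finset.card_le_card_of_injOn (fun p => (F p.1, F p.2))
      · rintro ⟨i, j⟩ hp
        simp only [Finset.coe_filter, Finset.mem_univ, true_and, Set.mem_setOf_eq] at hp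
        obtain ⟨hi, hij, hreg⟩ := hp
        have hj : j ≠ 0 := (lt_of_le_of_lt (Fin.zero_le i) hij).ne'
        have hne : F i ≠ F j := fun h => hij.ne (hFinj i j hi hj h)
        obtain ⟨i, rfl⟩ := Fin.exists_succ_eq.2 hi
        obtain ⟨j, rfl⟩ := Fin.exists_succ_eq.2 hj
        simp only [Fin.cons_succ] at hreg
        refine Finset.mem_coe.2 ((Q.mk_mem_nonUniforms G).2 ⟨(e i).2, (e j).2, hne, ?_⟩)
        intro hun
        exact hreg (regular_of_uniform G ε hε0 hε1 q hq (e i).1 (e j).1 _ _ (hf _) (hf _)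
          (hgc i) (hgc j) (hup _ (e i).2) (hup _ (e j).2) hun)
      · rintro ⟨i, j⟩ hp ⟨i', j'⟩ hp' h
        simp only [Finset.coe_filter, Finset.mem_univ, true_and, Set.mem_setOf_eq] at hp hp'
        have hj : j ≠ 0 := (lt_of_le_of_lt (Fin.zero_le i) hp.2.1).ne'
        have hj' : j' ≠ 0 := (lt_of_le_of_lt (Fin.zero_le i') hp'.2.1).ne'
        have h' := Prod.mk.inj h
        rw [hFinj i i' hp.1 hp'.1 h'.1, hFinj j j' hj hj' h'.2]
    unfold Finpartition.IsUniform at hQu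
    rw [← hk] at hQu
    have h1 : ((k * (k - 1) : ℕ) : ℝ) ≤ (k : ℝ) ^ 2 := by
      exact_mod_cast (by rw [sq]; exact Nat.mul_le_mul_left k (Nat.sub_le k 1))
    refine (Nat.cast_le.2 hle).trans (hQu.trans ?_)
    nlinarith [sq_nonneg (k : ℝ)]
end

section
/- (Sparse structure theorem, toy version, finitary form) For every 0 < ε < 1 and every function F: ℤ⁺ → ℝ⁺ there exist a bound M₀ = M₀(F, ε) and a δ = δ(F, ε) > 0, depending only on F and ε, with the following property: let (X, 𝒳, μ) be a probability space, let 𝒮 be a collection of sub-σ-algebras of 𝒳, and let ν ∈ L¹(μ) be a non-negative function such that ‖E(ν|ℬ)‖_{L^∞(μ)} ≤ 1 + δ for every sub-σ-algebra ℬ of complexity at most M₀. Then for every measurable f: X → ℝ with 0 ≤ f(x) ≤ ν(x) for all x ∈ X, there exist a positive integer M ≤ M₀, a sub-σ-algebra ℬ of complexity at most M, and a decomposition f = f_str + f_psd + f_err such that f_str = E(f|ℬ), f_psd is 1/F(M)-pseudorandom, ‖f_err‖_{L²(μ)} ≤ ε, and moreover 0 ≤ f_str ≤ 1 + δ almost everywhere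 and ∫_X f_str dμ = ∫_X f dμ. -/
open MeasureTheory

/-- A sub-σ-algebra has complexity at most `M` (relative to the collection `𝒮`)
if it is the join of at most `M` elements of `𝒮`. -/
def HasComplexityAtMost {X : Type*} (𝒮 : Set (MeasurableSpace X)) (M : ℕ)
    (ℬ : MeasurableSpace X) : Prop :=
  ∃ m : ℕ, m ≤ M ∧ ∃ Y : Fin m → MeasurableSpace X,
    (∀ i, Y i ∈ 𝒮) ∧ ℬ = ⨆ i, Y i

lemma HasComplexityAtMost.mono' {X : Type*} {𝒮 : Set (MeasurableSpace X)} {M N : ℕ}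
    {ℬ : MeasurableSpace X} (h : HasComplexityAtMost 𝒮 M ℬ) (hMN : M ≤ N) :
    HasComplexityAtMost 𝒮 N ℬ := by
  obtain ⟨m, hm, Y, hY⟩ := h
  exact ⟨m, hm.trans hMN, Y, hY⟩

lemma HasComplexityAtMost.sup' {X : Type*} {𝒮 : Set (MeasurableSpace X)} {M : ℕ}
    {ℬ 𝒴 : MeasurableSpace X} (h : HasComplexityAtMost 𝒮 M ℬ) (hy : 𝒴 ∈ 𝒮) :
    HasComplexityAtMost 𝒮 (M + 1) (ℬ ⊔ 𝒴) := by
  obtain ⟨m, hm, Y, hY, rfl⟩ := h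
  refine ⟨m + 1, by omega, Fin.cons 𝒴 Y, ?_, ?_⟩
  · intro i
    refine Fin.cases ?_ ?_ i
    · simpa using hy
    · intro j
      simpa using hY j
  · apply le_antisymm
    · refine sup_le (iSup_le fun i => ?_) ?_
      · exact le_iSup_of_le i.succ (by simp)
      · exact le_iSup_of_le 0 (by simp)
    · refine iSup_le fun i => ?_
      refine Fin.cases ?_ ?_ i
      · simp
      · intro j
        simp only [Fin.cons_succ]
        exact le_sup_of_le_left (le_iSup Y j)

lemma HasComplexityAtMost.le' {X : Type*} {𝒮 : Set (MeasurableSpace X)} {M : ℕ}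
    {ℬ 𝒳 : MeasurableSpace X} (h : HasComplexityAtMost 𝒮 M ℬ) (hS : ∀ 𝒴 ∈ 𝒮, 𝒴 ≤ 𝒳) :
    ℬ ≤ 𝒳 := by
  obtain ⟨m, hm, Y, hY, rfl⟩ := h
  exact iSup_le fun i => hS _ (hY i)

/-- Inner energy increment iteration. -/
lemma energy_inner {X : Type*} (𝒮 : Set (MeasurableSpace X)) (M₀ : ℕ)
    (En : MeasurableSpace X → ℝ) (hE : ∀ ℬ, HasComplexityAtMost 𝒮 M₀ ℬ → En ℬ ≤ 4)
    (PR : MeasurableSpace X → Prop) (η : ℝ) (hη : 0 < η)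
    (hinc : ∀ ℬ, HasComplexityAtMost 𝒮 M₀ ℬ → ¬ PR ℬ →
      ∃ 𝒴 ∈ 𝒮, HasComplexityAtMost 𝒮 M₀ (ℬ ⊔ 𝒴) → En ℬ + η ≤ En (ℬ ⊔ 𝒴)) (k : ℕ) :
    ∀ (m : ℕ) (ℬ : MeasurableSpace X), HasComplexityAtMost 𝒮 m ℬ → 4 - k * η ≤ En ℬ →
      m + k + 1 ≤ M₀ → ∃ ℬ', ℬ ≤ ℬ' ∧ HasComplexityAtMost 𝒮 (m + k) ℬ' ∧ PR ℬ' := by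
  induction k with
  | zero =>
    intro m ℬ hC hk hm
    by_cases hP : PR ℬ
    · exact ⟨ℬ, le_rfl, hC, hP⟩
    obtain ⟨𝒴, hy, h⟩ := hinc ℬ (hC.mono' (by omega)) hP
    have hC' : HasComplexityAtMost 𝒮 M₀ (ℬ ⊔ 𝒴) := (hC.sup' hy).mono' (by omega)
    have := h hC'
    have := hE _ hC'
    simp at hk
    linarith
  | succ k ih =>
    intro m ℬ hC hk hm
    by_cases hP : PR ℬ
    · exact ⟨ℬ, le_rfl, hC.mono' (by omega), hP⟩
    obtain ⟨𝒴, hy, h⟩ := hinc ℬ (hC.mono' (by omega)) hP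
    have hC' : HasComplexityAtMost 𝒮 M₀ (ℬ ⊔ 𝒴) := (hC.sup' hy).mono' (by omega)
    have := h hC'
    push_cast at hk
    obtain ⟨ℬ', h1, h2, h3⟩ := ih (m + 1) (ℬ ⊔ 𝒴) (hC.sup' hy) (by linarith) (by omega)
    exact ⟨ℬ', le_sup_left.trans h1, h2.mono' (by omega), h3⟩

/-- The growth function of one outer step. -/
noncomputable def growthStep (F : ℕ → ℝ) (m : ℕ) : ℕ := m + ⌈4 * F m ^ 2⌉₊ + 1

lemma le_growthStep_iterate (F : ℕ → ℝ) (k m : ℕ) : m ≤ (growthStep F)^[k] m :=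
  Function.id_le_iterate_of_id_le (fun m => by simp only [growthStep, id]; omega) k m

lemma energy_outer {X : Type*} (𝒮 : Set (MeasurableSpace X)) (M₀ : ℕ)
    (En : MeasurableSpace X → ℝ) (hE : ∀ ℬ, HasComplexityAtMost 𝒮 M₀ ℬ → En ℬ ≤ 4)
    (hE0 : ∀ ℬ, 0 ≤ En ℬ)
    (F : ℕ → ℝ) (hF : ∀ M, 1 ≤ M → 0 < F M)
    (PR : ℝ → MeasurableSpace X → Prop) (ε : ℝ)
    (hinc : ∀ c, 0 < c → ∀ ℬ, HasComplexityAtMost 𝒮 M₀ ℬ → ¬ PR c ℬ →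
      ∃ 𝒴 ∈ 𝒮, HasComplexityAtMost 𝒮 M₀ (ℬ ⊔ 𝒴) → En ℬ + c ^ 2 ≤ En (ℬ ⊔ 𝒴)) (k : ℕ) :
    ∀ (m : ℕ) (ℬ : MeasurableSpace X), 1 ≤ m → HasComplexityAtMost 𝒮 m ℬ →
      4 - k * ε ^ 2 ≤ En ℬ → (growthStep F)^[k + 1] m ≤ M₀ →
      ∃ M, 1 ≤ M ∧ M ≤ M₀ ∧ ∃ ℬ ℬ', ℬ ≤ ℬ' ∧ HasComplexityAtMost 𝒮 M ℬ ∧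
        HasComplexityAtMost 𝒮 M₀ ℬ' ∧ PR (1 / F M) ℬ' ∧ En ℬ' - En ℬ ≤ ε ^ 2 := by
  have key : ∀ (m : ℕ) (ℬ : MeasurableSpace X), 1 ≤ m → HasComplexityAtMost 𝒮 m ℬ →
      growthStep F m ≤ M₀ → ∃ ℬ', ℬ ≤ ℬ' ∧ HasComplexityAtMost 𝒮 (growthStep F m) ℬ' ∧
        PR (1 / F m) ℬ' := by
    intro m ℬ hm hC hG
    have hc : 0 < 1 / F m := by have := hF m hm; positivity
    obtain ⟨ℬ', h1, h2, h3⟩ := energy_inner 𝒮 M₀ En hE (PR (1 / F m)) ((1 / F m) ^ 2)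
      (by positivity) (hinc _ hc) ⌈4 * F m ^ 2⌉₊ m ℬ hC (by
        have h4 := Nat.le_ceil (4 * F m ^ 2)
        have hFm := hF m hm
        have h5 : 4 * F m ^ 2 * (1 / F m) ^ 2 ≤ ⌈4 * F m ^ 2⌉₊ * (1 / F m) ^ 2 := by
          gcongr
        have h6 : 4 * F m ^ 2 * (1 / F m) ^ 2 = 4 := by field_simp
        have := hE0 ℬ
        linarith) hG
    exact ⟨ℬ', h1, h2.mono' (by simp only [growthStep]; omega), h3⟩
  induction k with
  | zero =>
    intro m ℬ hm hC hk hG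
    simp only [zero_add, Function.iterate_one] at hG
    obtain ⟨ℬ', h1, h2, h3⟩ := key m ℬ hm hC hG
    have hmM : m ≤ M₀ := by simp only [growthStep] at hG; omega
    refine ⟨m, hm, hmM, ℬ, ℬ', h1, hC, h2.mono' hG, h3, ?_⟩
    have := hE _ (h2.mono' hG)
    simp at hk
    nlinarith [sq_nonneg ε]
  | succ k ih =>
    intro m ℬ hm hC hk hG
    rw [Function.iterate_succ_apply] at hG
    have hG' : growthStep F m ≤ M₀ := (le_growthStep_iterate F _ _).trans hG
    have hmM : m ≤ growthStep F m := by simp only [growthStep]; omega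
    obtain ⟨ℬ', h1, h2, h3⟩ := key m ℬ hm hC hG'
    by_cases hen : En ℬ' - En ℬ ≤ ε ^ 2
    · exact ⟨m, hm, hmM.trans hG', ℬ, ℬ', h1, hC, h2.mono' hG', h3, hen⟩
    · push_cast at hk
      exact ih (growthStep F m) ℬ' (hm.trans hmM) h2 (by linarith) hG

lemma eLpNorm_two_eq_sqrt {X : Type*} {m0 : MeasurableSpace X} {μ : Measure X} {g : X → ℝ}
    (hg : MemLp g 2 μ) : eLpNorm g 2 μ = ENNReal.ofReal (Real.sqrt (∫ x, g x ^ 2 ∂μ)) := by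
  rw [hg.eLpNorm_eq_integral_rpow_norm (by simp) (by simp)]
  simp [Real.sqrt_eq_rpow]

lemma energy_pythagoras {X : Type*} {m m0 : MeasurableSpace X} {μ : Measure X}
    [IsProbabilityMeasure μ] (hm : m ≤ m0) {g h : X → ℝ} (hg : MemLp g 2 μ)
    (hh : MemLp h 2 μ) (hhm : StronglyMeasurable[m] h) (hgh : μ[g|m] =ᵐ[μ] h) :
    ∫ x, (g - h) x ^ 2 ∂μ = ∫ x, g x ^ 2 ∂μ - ∫ x, h x ^ 2 ∂μ := by
  have hi : Integrable (g * h) μ := hg.integrable_mul hh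
  have h1 : ∫ x, (g * h) x ∂μ = ∫ x, h x ^ 2 ∂μ := by
    rw [← integral_condExp hm]
    apply integral_congr_ae
    filter_upwards [condExp_mul_of_stronglyMeasurable_right hhm hi (hg.integrable (by simp)),
      hgh] with x hx hx2
    rw [hx, Pi.mul_apply, hx2, sq]
  have e : ∀ x, (g - h) x ^ 2 = g x ^ 2 - 2 * (g * h) x + h x ^ 2 := by
    intro x
    simp only [Pi.sub_apply, Pi.mul_apply]
    ring
  have i1 : Integrable (fun x => g x ^ 2 - 2 * (g * h) x) μ :=
    hg.integrable_sq.sub (hi.const_mul 2)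
  simp_rw [e]
  rw [integral_add i1 hh.integrable_sq,
    integral_sub hg.integrable_sq (hi.const_mul 2), integral_const_mul, h1]
  ring

/-- sparse structure theorem, toy version, finitary form. -/
theorem sparse_structure_theorem_toy
    (ε : ℝ) (hε0 : 0 < ε) (hε1 : ε < 1) (F : ℕ → ℝ) (hF : ∀ M, 1 ≤ M → 0 < F M) :
    ∃ (M₀ : ℕ) (δ : ℝ), 0 < δ ∧
      ∀ (X : Type*) (𝒳 : MeasurableSpace X) (μ : Measure X),
        IsProbabilityMeasure μ →
        ∀ 𝒮 : Set (MeasurableSpace X), (∀ 𝒴 ∈ 𝒮, 𝒴 ≤ 𝒳) →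
        ∀ ν : X → ℝ, Integrable ν μ → (∀ x, 0 ≤ ν x) →
        (∀ ℬ : MeasurableSpace X, HasComplexityAtMost 𝒮 M₀ ℬ →
          eLpNorm (μ[ν|ℬ]) ⊤ μ ≤ ENNReal.ofReal (1 + δ)) →
        ∀ f : X → ℝ, Measurable f → (∀ x, 0 ≤ f x ∧ f x ≤ ν x) →
          ∃ M : ℕ, 1 ≤ M ∧ M ≤ M₀ ∧
            ∃ ℬ : MeasurableSpace X, HasComplexityAtMost 𝒮 M ℬ ∧
              ∃ fpsd ferr : X → ℝ,
                f = μ[f|ℬ] + fpsd + ferr ∧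
                (∀ 𝒴 ∈ 𝒮, eLpNorm (μ[fpsd|𝒴]) 2 μ ≤ ENNReal.ofReal (1 / F M)) ∧
                eLpNorm ferr 2 μ ≤ ENNReal.ofReal ε ∧
                (∀ᵐ x ∂μ, 0 ≤ (μ[f|ℬ]) x ∧ (μ[f|ℬ]) x ≤ 1 + δ) ∧
                ∫ x, (μ[f|ℬ]) x ∂μ = ∫ x, f x ∂μ := by
  obtain ⟨K, hK⟩ := exists_nat_ge (4 / ε ^ 2)
  refine ⟨(growthStep F)^[K + 1] 1, 1, one_pos, ?_⟩
  intro X 𝒳 μ hμ 𝒮 hS ν hν hν0 hbd f hf hfν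
  generalize hM₀ : (growthStep F)^[K + 1] 1 = M₀ at hbd ⊢
  have hfi : Integrable f μ := hν.mono' hf.aestronglyMeasurable
    (Filter.Eventually.of_forall fun x => by
      rw [Real.norm_eq_abs, abs_of_nonneg (hfν x).1]
      exact (hfν x).2)
  have hb : ∀ ℬ, HasComplexityAtMost 𝒮 M₀ ℬ →
      ∀ᵐ x ∂μ, 0 ≤ (μ[f|ℬ]) x ∧ (μ[f|ℬ]) x ≤ 1 + 1 := by
    intro ℬ hC
    have h1 : 0 ≤ᵐ[μ] μ[f|ℬ] :=
      condExp_nonneg (Filter.Eventually.of_forall fun x => (hfν x).1)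
    have h2 : μ[f|ℬ] ≤ᵐ[μ] μ[ν|ℬ] :=
      condExp_mono hfi hν (Filter.Eventually.of_forall fun x => (hfν x).2)
    have h3 := hbd ℬ hC
    rw [eLpNorm_exponent_top] at h3
    have h4 := enorm_ae_le_eLpNormEssSup (μ[ν|ℬ]) μ
    filter_upwards [h1, h2, h4] with x hx1 hx2 hx4
    refine ⟨hx1, hx2.trans ?_⟩
    have h5 := hx4.trans h3
    rw [← ofReal_norm, ENNReal.ofReal_le_ofReal_iff (by norm_num)] at h5
    exact (le_abs_self _).trans h5
  have hL : ∀ ℬ, HasComplexityAtMost 𝒮 M₀ ℬ → MemLp (μ[f|ℬ]) 2 μ := by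
    intro ℬ hC
    refine MemLp.of_bound integrable_condExp.aestronglyMeasurable 2 ?_
    filter_upwards [hb ℬ hC] with x hx
    rw [Real.norm_eq_abs, abs_of_nonneg hx.1]
    linarith [hx.2]
  have hpyth : ∀ ℬ ℬ', ℬ ≤ ℬ' → HasComplexityAtMost 𝒮 M₀ ℬ → HasComplexityAtMost 𝒮 M₀ ℬ' →
      ∫ x, (μ[f|ℬ'] - μ[f|ℬ]) x ^ 2 ∂μ
        = ∫ x, (μ[f|ℬ']) x ^ 2 ∂μ - ∫ x, (μ[f|ℬ]) x ^ 2 ∂μ := by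
    intro ℬ ℬ' hle hC hC'
    exact energy_pythagoras (hC.le' hS) (hL ℬ' hC') (hL ℬ hC) stronglyMeasurable_condExp
      (condExp_condExp_of_le hle (hC'.le' hS))
  have hmain := energy_outer 𝒮 M₀ (fun ℬ => ∫ x, (μ[f|ℬ]) x ^ 2 ∂μ) ?_ ?_ F hF
    (fun c ℬ => ∀ 𝒴 ∈ 𝒮, eLpNorm (μ[f - μ[f|ℬ]|𝒴]) 2 μ ≤ ENNReal.ofReal c) ε ?_ K 1 ⊥
    le_rfl ⟨0, Nat.zero_le _, fun i => i.elim0, fun i => i.elim0, (iSup_of_empty _).symm⟩ ?_ hM₀.le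
  · obtain ⟨M, hM1, hM, ℬ, ℬ', hle, hC, hC', hPR, hen⟩ := hmain
    have hCM := hC.mono' hM
    refine ⟨M, hM1, hM, ℬ, hC, f - μ[f|ℬ'], μ[f|ℬ'] - μ[f|ℬ], by abel, hPR, ?_, hb ℬ hCM,
      integral_condExp (hC.le' hS)⟩
    rw [eLpNorm_two_eq_sqrt ((hL ℬ' hC').sub (hL ℬ hCM)), hpyth ℬ ℬ' hle hCM hC']
    apply ENNReal.ofReal_le_ofReal
    rw [Real.sqrt_le_left hε0.le]
    exact hen
  · intro ℬ hC
    have h1 : ∫ x, (μ[f|ℬ]) x ^ 2 ∂μ ≤ ∫ x, (4 : ℝ) ∂μ := by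
      apply integral_mono_ae (hL ℬ hC).integrable_sq (integrable_const _)
      filter_upwards [hb ℬ hC] with x hx
      nlinarith [hx.1, hx.2]
    simpa using h1
  · intro ℬ
    exact integral_nonneg fun x => sq_nonneg _
  · intro c hc ℬ hC hP
    push Not at hP
    obtain ⟨𝒴, hy, hlt⟩ := hP
    refine ⟨𝒴, hy, fun hC' => ?_⟩
    have h1 : μ[f - μ[f|ℬ]|𝒴] =ᵐ[μ] μ[μ[f|ℬ ⊔ 𝒴] - μ[f|ℬ]|𝒴] := by
      have e1 := condExp_sub hfi (integrable_condExp (m := ℬ) (f := f) (μ := μ)) 𝒴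
      have e2 := condExp_sub (integrable_condExp (m := ℬ ⊔ 𝒴) (f := f) (μ := μ))
        (integrable_condExp (m := ℬ) (f := f) (μ := μ)) 𝒴
      have e3 := condExp_condExp_of_le (f := f) (μ := μ) (le_sup_right : 𝒴 ≤ ℬ ⊔ 𝒴) (hC'.le' hS)
      filter_upwards [e1, e2, e3] with x h1 h2 h3
      rw [h1, h2, Pi.sub_apply, Pi.sub_apply, h3]
    have h2 : ENNReal.ofReal c < eLpNorm (μ[f|ℬ ⊔ 𝒴] - μ[f|ℬ]) 2 μ := by
      refine hlt.trans_le ?_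
      rw [eLpNorm_congr_ae h1]
      exact eLpNorm_condExp_le_eLpNorm _ (by norm_num)
    rw [eLpNorm_two_eq_sqrt ((hL _ hC').sub (hL ℬ hC)), hpyth _ _ le_sup_left hC hC',
      ENNReal.ofReal_lt_ofReal_iff_of_nonneg hc.le, Real.lt_sqrt hc.le] at h2
    linarith
  · have h1 : 4 ≤ K * ε ^ 2 := by
      rwa [div_le_iff₀ (by positivity)] at hK
    have h2 : 0 ≤ ∫ x, (μ[f|⊥]) x ^ 2 ∂μ := integral_nonneg fun x => sq_nonneg _
    linarith
end
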